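/- Fix k ∈ ℕ and define the weight μ_k of an atom by μ_k(a°) = 1 for single atoms and μ_k(Δ*) = (k+1)^{|Δ|} for alphabet atoms, extended additively to sequences of atoms. For reduced ideal representations α₁⋯αₙ and β₁⋯β_m of ideals I and J with n, m ≤ k: if I ⊆ J then μ_k(α₁⋯αₙ) ≤ μ_k(β₁⋯β_m), and if moreover I ⊊ J then the inequality is strict. -/

import Mathlib

def IsDirectedLang {A : Type*} (L : Set (List A)) : Prop :=
  ∀ u ∈ L, ∀ v ∈ L, ∃ w ∈ L, u.Sublist w ∧ v.Sublist w

def dcl {A : Type*} (L : Set (List A)) : Set (List A) := {u | ∃ v ∈ L, u.Sublist v}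

def DownwardClosed {A : Type*} (D : Set (List A)) : Prop :=
  ∀ u v : List A, u.Sublist v → v ∈ D → u ∈ D

def IsIdeal {A : Type*} (I : Set (List A)) : Prop :=
  I.Nonempty ∧ DownwardClosed I ∧ IsDirectedLang I

inductive Atom (A : Type*) where
  | single : A → Atom A
  | alph : Finset A → Atom A

def Atom.lang {A : Type*} : Atom A → Set (List A)
  | .single a => {[], [a]}
  | .alph d => {w | ∀ c ∈ w, c ∈ d}

def Atom.Valid {A : Type*} : Atom A → Prop
  | .single _ => True
  | .alph d => d.Nonempty

def conc {A : Type*} (L M : Set (List A)) : Set (List A) :=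
  {w | ∃ u ∈ L, ∃ v ∈ M, w = u ++ v}

def Idl {A : Type*} : List (Atom A) → Set (List A)
  | [] => {[]}
  | α :: r => conc α.lang (Idl r)

def LeftAbsorbs {A : Type*} (α β : Atom A) : Prop := Idl [α, β] = Idl [α]
def RightAbsorbs {A : Type*} (α β : Atom A) : Prop := Idl [α, β] = Idl [β]
def Absorptive {A : Type*} (α β : Atom A) : Prop := LeftAbsorbs α β ∨ RightAbsorbs α β
def Reduced {A : Type*} (r : List (Atom A)) : Prop := r.Chain' fun α β => ¬ Absorptive α β

def atomWeight {A : Type*} (k : ℕ) : Atom A → ℕ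
  | .single _ => 1
  | .alph d => (k+1) ^ d.card

def repWeight {A : Type*} (k : ℕ) (r : List (Atom A)) : ℕ := (r.map (atomWeight k)).sum

theorem Atom.nil_mem_lang {A : Type*} (α : Atom A) : [] ∈ α.lang := by
  cases α <;> simp [Atom.lang]

theorem Atom.lang_downwardClosed {A : Type*} (α : Atom A) : DownwardClosed α.lang := by
  intro u v huv hv
  cases α with
  | single a =>
    rcases hv with rfl | hv
    · exact Or.inl (List.sublist_nil.mp huv)
    · rw [Set.mem_singleton_iff] at hv
      subst hv
      simpa [Atom.lang, List.sublist_singleton] using huv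
  | alph d => exact fun c hc => hv c (huv.subset hc)

theorem Idl_downwardClosed {A : Type*} (r : List (Atom A)) : DownwardClosed (Idl r) := by
  induction r with
  | nil =>
    rintro u v huv rfl
    exact List.sublist_nil.mp huv
  | cons α r ih =>
    rintro w - hw ⟨u, hu, v, hv, rfl⟩
    obtain ⟨u', v', rfl, hu', hv'⟩ := List.sublist_append_iff.mp hw
    exact ⟨u', α.lang_downwardClosed _ _ hu' hu, v', ih _ _ hv' hv, rfl⟩

theorem nil_mem_Idl {A : Type*} (r : List (Atom A)) : [] ∈ Idl r := by
  induction r with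
  | nil => rfl
  | cons α r ih => exact ⟨[], α.nil_mem_lang, [], ih, rfl⟩

theorem Idl_subset_Idl_cons {A : Type*} (α : Atom A) (r : List (Atom A)) :
    Idl r ⊆ Idl (α :: r) :=
  fun w hw => ⟨[], α.nil_mem_lang, w, hw, rfl⟩

theorem Idl_singleton {A : Type*} (α : Atom A) : Idl [α] = α.lang := by
  ext w
  simp [Idl, conc]

theorem Idl_pair {A : Type*} (α β : Atom A) : Idl [α, β] = conc α.lang β.lang := by
  rw [Idl, Idl_singleton]

/-- An atom included in an alphabet atom is absorbed by it from either side. -/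
theorem absorptive_of_lang_subset {A : Type*} {α : Atom A} {Γ : Finset A}
    (h : α.lang ⊆ (Atom.alph Γ).lang) :
    Absorptive α (.alph Γ) ∧ Absorptive (.alph Γ) α := by
  constructor
  · right
    rw [RightAbsorbs, Idl_pair, Idl_singleton]
    apply Set.Subset.antisymm
    · rintro - ⟨u, hu, v, hv, rfl⟩ c hc
      rcases List.mem_append.mp hc with hc | hc
      · exact h hu c hc
      · exact hv c hc
    · exact fun w hw => ⟨[], α.nil_mem_lang, w, hw, rfl⟩
  · left
    rw [LeftAbsorbs, Idl_pair, Idl_singleton]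
    apply Set.Subset.antisymm
    · rintro - ⟨u, hu, v, hv, rfl⟩ c hc
      rcases List.mem_append.mp hc with hc | hc
      · exact hu c hc
      · exact h hv c hc
    · exact fun w hw => ⟨w, hw, [], α.nil_mem_lang, by simp⟩

/-- If `[c]` belongs to the first atom, every word of the ideal is a subword of a word of the ideal
starting with `c`. -/
theorem exists_cons_mem_Idl {A : Type*} {α : Atom A} {r : List (Atom A)} {c : A}
    (hc : [c] ∈ α.lang) {w : List A} (hw : w ∈ Idl (α :: r)) :
    ∃ v, c :: v ∈ Idl (α :: r) ∧ w.Sublist (c :: v) := by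
  obtain ⟨u, hu, v, hv, rfl⟩ := hw
  cases α with
  | single a =>
    have hca : c = a := by simpa [Atom.lang] using hc
    subst hca
    refine ⟨v, ⟨[c], hc, v, hv, rfl⟩, ?_⟩
    rcases hu with rfl | hu
    · simp
    · rw [Set.mem_singleton_iff] at hu
      simp [hu]
  | alph d =>
    have hcd : c ∈ d := by simpa [Atom.lang] using hc
    refine ⟨u ++ v, ⟨c :: u, ?_, v, hv, rfl⟩, List.sublist_cons_self _ _⟩
    intro e he
    rcases List.mem_cons.mp he with rfl | he
    · exact hcd
    · exact hu e he

theorem Idl_subset_of_not_mem_alph {A : Type*} {α : Atom A} {Γ : Finset A}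
    {r b : List (Atom A)} (hα : ¬ α.lang ⊆ (Atom.alph Γ).lang)
    (h : Idl (α :: r) ⊆ Idl (.alph Γ :: b)) : Idl (α :: r) ⊆ Idl b := by
  obtain ⟨u, hu, hΓ⟩ := Set.not_subset.mp hα
  obtain ⟨c, hcu, hcΓ⟩ : ∃ c ∈ u, c ∉ Γ := by simpa [Atom.lang] using hΓ
  intro w hw
  obtain ⟨v, hv, hwv⟩ := exists_cons_mem_Idl
    (α.lang_downwardClosed _ _ (List.singleton_sublist.mpr hcu) hu) hw
  obtain ⟨p, hp, q, hq, hpq⟩ := h hv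
  cases p with
  | nil => exact Idl_downwardClosed b _ _ hwv (by simpa [hpq] using hq)
  | cons e p =>
    obtain ⟨rfl, -⟩ := List.cons.inj hpq
    exact absurd (hp c List.mem_cons_self) hcΓ

theorem exists_split_alph {A : Type*} (Γ : Finset A) (a b : List (Atom A))
    (h : Idl a ⊆ Idl (.alph Γ :: b)) :
    ∃ s t, a = s ++ t ∧ (∀ α ∈ s, α.lang ⊆ (Atom.alph Γ).lang) ∧ Idl t ⊆ Idl b := by
  induction a with
  | nil =>
    refine ⟨[], [], rfl, by simp, ?_⟩
    rintro w rfl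
    exact nil_mem_Idl b
  | cons α r ih =>
    by_cases hα : α.lang ⊆ (Atom.alph Γ).lang
    · obtain ⟨s, t, rfl, hs, ht⟩ := ih ((Idl_subset_Idl_cons α r).trans h)
      exact ⟨α :: s, t, rfl, by simpa using ⟨hα, hs⟩, ht⟩
    · exact ⟨[], α :: r, rfl, by simp, Idl_subset_of_not_mem_alph hα h⟩

theorem exists_split_single {A : Type*} (c : A) (a b : List (Atom A))
    (ha : ∀ α ∈ a, α.Valid) (h : Idl a ⊆ Idl (.single c :: b)) :
    ∃ s t, a = s ++ t ∧ (s = [] ∨ s = [.single c]) ∧ Idl t ⊆ Idl b := by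
  have tail_mem : ∀ {e : A} {v : List A}, e :: v ∈ Idl (.single c :: b) →
      e :: v ∈ Idl b ∨ (e = c ∧ v ∈ Idl b) := by
    rintro e v ⟨p, hp, q, hq, hpq⟩
    rcases hp with rfl | hp
    · left
      simpa [hpq] using hq
    · rw [Set.mem_singleton_iff] at hp
      subst hp
      obtain ⟨rfl, rfl⟩ := List.cons.inj hpq
      exact Or.inr ⟨rfl, by simpa using hq⟩
  cases a with
  | nil =>
    refine ⟨[], [], rfl, Or.inl rfl, ?_⟩
    rintro w rfl
    exact nil_mem_Idl b
  | cons α r =>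
    cases α with
    | single d =>
      by_cases hd : d = c
      · subst hd
        refine ⟨[.single d], r, rfl, Or.inr rfl, fun w hw => ?_⟩
        rcases tail_mem (h ⟨[d], by simp [Atom.lang], w, hw, rfl⟩) with hw' | ⟨-, hw'⟩
        · exact Idl_downwardClosed b _ _ (List.sublist_cons_self _ _) hw'
        · exact hw'
      · refine ⟨[], .single d :: r, rfl, Or.inl rfl, fun w hw => ?_⟩
        obtain ⟨v, hv, hwv⟩ := exists_cons_mem_Idl (c := d) (by simp [Atom.lang]) hw
        rcases tail_mem (h hv) with hw' | ⟨hdc, -⟩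
        · exact Idl_downwardClosed b _ _ hwv hw'
        · exact absurd hdc hd
    | alph Δ =>
      refine ⟨[], .alph Δ :: r, rfl, Or.inl rfl, ?_⟩
      obtain ⟨d, hd⟩ : Δ.Nonempty := ha _ List.mem_cons_self
      rintro - ⟨u, hu, v, hv, rfl⟩
      have hmem : d :: (u ++ v) ∈ Idl (.alph Δ :: r) := by
        refine ⟨d :: u, ?_, v, hv, rfl⟩
        intro e he
        rcases List.mem_cons.mp he with rfl | he
        · exact hd
        · exact hu e he
      rcases tail_mem (h hmem) with hw' | ⟨-, hw'⟩
      · exact Idl_downwardClosed b _ _ (List.sublist_cons_self _ _) hw'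
      · exact hw'

theorem eq_nil_of_Idl_subset_nil {A : Type*} {a : List (Atom A)}
    (ha : ∀ α ∈ a, α.Valid) (h : Idl a ⊆ Idl []) : a = [] := by
  cases a with
  | nil => rfl
  | cons α r =>
    obtain ⟨c, hc⟩ : ∃ c, [c] ∈ α.lang := by
      cases α with
      | single c => exact ⟨c, by simp [Atom.lang]⟩
      | alph Δ =>
        obtain ⟨c, hc⟩ : Δ.Nonempty := ha _ List.mem_cons_self
        exact ⟨c, by simpa [Atom.lang] using hc⟩
    have hmem : [c] ∈ Idl ([] : List (Atom A)) := h ⟨[c], hc, [], nil_mem_Idl r, rfl⟩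
    exact absurd hmem (List.cons_ne_nil _ _)

theorem atomWeight_le_of_lang_subset {A : Type*} (k : ℕ) {α : Atom A} {Γ : Finset A}
    (h : α.lang ⊆ (Atom.alph Γ).lang) (hne : α ≠ .alph Γ) :
    atomWeight k α ≤ (k + 1) ^ (Γ.card - 1) := by
  cases α with
  | single c => exact Nat.one_le_pow _ _ (Nat.succ_pos k)
  | alph Δ =>
    have hsub : Δ ⊆ Γ := fun c hc =>
      h (show [c] ∈ (Atom.alph Δ).lang by simpa [Atom.lang] using hc) c (by simp)
    have hlt : Δ.card < Γ.card :=
      Finset.card_lt_card (hsub.ssubset_of_ne fun he => hne (congrArg Atom.alph he))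
    exact Nat.pow_le_pow_right (Nat.succ_pos k) (by omega)

theorem eq_singleton_or_repWeight_lt {A : Type*} (k : ℕ) {Γ : Finset A} (hΓ : Γ.Nonempty)
    {s : List (Atom A)} (hs : Reduced s) (hk : s.length ≤ k)
    (hsub : ∀ α ∈ s, α.lang ⊆ (Atom.alph Γ).lang) :
    s = [.alph Γ] ∨ repWeight k s < atomWeight k (.alph Γ) := by
  by_cases hmem : Atom.alph Γ ∈ s
  · left
    obtain ⟨p, q, rfl⟩ := List.append_of_mem hmem
    have hchain := List.isChain_append.mp hs
    have hp : p = [] := by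
      rcases p.eq_nil_or_concat with rfl | ⟨p, y, rfl⟩
      · rfl
      · exact absurd (absorptive_of_lang_subset (hsub y (by simp))).1
          (hchain.2.2 y (by simp) _ (by simp))
    have hq : q = [] := by
      cases q with
      | nil => rfl
      | cons y q =>
        exact absurd (absorptive_of_lang_subset (hsub y (by simp))).2
          (List.isChain_cons_cons.mp hchain.2.1).1
    simp [hp, hq]
  · right
    have hsum : repWeight k s ≤ s.length * (k + 1) ^ (Γ.card - 1) := by
      have := List.sum_le_card_nsmul (s.map (atomWeight k)) ((k + 1) ^ (Γ.card - 1)) (by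
        intro x hx
        obtain ⟨α, hα, rfl⟩ := List.mem_map.mp hx
        exact atomWeight_le_of_lang_subset k (hsub α hα) fun he => hmem (he ▸ hα))
      simpa [repWeight] using this
    calc repWeight k s ≤ s.length * (k + 1) ^ (Γ.card - 1) := hsum
      _ < (k + 1) * (k + 1) ^ (Γ.card - 1) :=
        Nat.mul_lt_mul_of_pos_right (by omega) (by positivity)
      _ = (k + 1) ^ Γ.card := by
        rw [← pow_succ', Nat.sub_add_cancel hΓ.card_pos]

theorem repWeight_append {A : Type*} (k : ℕ) (s t : List (Atom A)) :
    repWeight k (s ++ t) = repWeight k s + repWeight k t := by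
  simp [repWeight]

theorem repWeight_cons {A : Type*} (k : ℕ) (α : Atom A) (t : List (Atom A)) :
    repWeight k (α :: t) = atomWeight k α + repWeight k t := by
  simp [repWeight]

theorem eq_or_repWeight_lt_of_Idl_subset {A : Type*} (k : ℕ) (a b : List (Atom A))
    (ha : ∀ α ∈ a, α.Valid) (hb : ∀ α ∈ b, α.Valid) (hra : Reduced a)
    (hla : a.length ≤ k) (h : Idl a ⊆ Idl b) : a = b ∨ repWeight k a < repWeight k b := by
  induction b generalizing a with
  | nil => exact Or.inl (eq_nil_of_Idl_subset_nil ha h)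
  | cons β b ih =>
    obtain ⟨s, t, rfl, hs, ht⟩ : ∃ s t, a = s ++ t ∧
        (s = [β] ∨ repWeight k s < atomWeight k β) ∧ Idl t ⊆ Idl b := by
      cases β with
      | single c =>
        obtain ⟨s, t, rfl, hs, ht⟩ := exists_split_single c a b ha h
        refine ⟨s, t, rfl, ?_, ht⟩
        rcases hs with rfl | rfl
        · right
          simp [repWeight, atomWeight]
        · exact Or.inl rfl
      | alph Γ =>
        obtain ⟨s, t, rfl, hs, ht⟩ := exists_split_alph Γ a b h
        refine ⟨s, t, rfl, ?_, ht⟩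
        rw [List.length_append] at hla
        exact eq_singleton_or_repWeight_lt k (hb _ List.mem_cons_self)
          (List.isChain_append.mp hra).1 (by omega) hs
    rw [List.length_append] at hla
    have hrec := ih t (fun α hα => ha α (List.mem_append_right _ hα))
      (fun α hα => hb α (List.mem_cons_of_mem _ hα))
      (List.isChain_append.mp hra).2.1 (by omega) ht
    rw [repWeight_append, repWeight_cons]
    rcases hs with rfl | hs
    · rcases hrec with rfl | hrec
      · exact Or.inl rfl
      · right
        simpa [repWeight] using hrec
    · right
      rcases hrec with rfl | hrec <;> omega

theorem weight_monotone {A : Type*} (k : ℕ) (a b : List (Atom A))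
    (ha : ∀ α ∈ a, α.Valid) (hb : ∀ α ∈ b, α.Valid)
    (hra : Reduced a) (hrb : Reduced b)
    (hla : a.length ≤ k) (hlb : b.length ≤ k) :
    (Idl a ⊆ Idl b → repWeight k a ≤ repWeight k b) ∧
    (Idl a ⊂ Idl b → repWeight k a < repWeight k b) := by
  refine ⟨fun h => ?_, fun h => ?_⟩
  · rcases eq_or_repWeight_lt_of_Idl_subset k a b ha hb hra hla h with rfl | hlt
    · exact le_rfl
    · exact hlt.le
  · rcases eq_or_repWeight_lt_of_Idl_subset k a b ha hb hra hla h.subset with rfl | hlt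
    · exact absurd h (ssubset_irrefl _)
    · exact hlt
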